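/- arXiv:1707.00288 — 2 statements merged into one kernel-verified Lean document; each statement's English description precedes it below -/
import Mathlib

section
/- Let R > 0. Define u₀ = R and u_n = R·e^{R·u_{n−1}} for n ≥ 1. Let v₀ ∈ ℝ and define v_n = e^{v_{n−1}} for n ≥ 1. Then there exists ℓ ∈ ℕ such that v_{n+ℓ} ≥ 2R·u_n for all n ∈ ℕ. -/
theorem iterated_exp_dominates
    (R : ℝ) (hR : 0 < R) (u v : ℕ → ℝ)
    (hu0 : u 0 = R) (hu : ∀ n, u (n + 1) = R * Real.exp (R * u n))
    (hv : ∀ n, v (n + 1) = Real.exp (v n)) :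
    ∃ ℓ : ℕ, ∀ n : ℕ, 2 * R * u n ≤ v (n + ℓ) := by
  have hstep : ∀ n, v n + 1 ≤ v (n + 1) := fun n => by
    rw [hv]; exact Real.add_one_le_exp _
  have hlin : ∀ n : ℕ, v 0 + n ≤ v n := by
    intro n
    induction n with
    | zero => simp
    | succ k ih => have := hstep k; push_cast; linarith
  obtain ⟨l, hl⟩ := exists_nat_ge (4 * R ^ 2 - v 0)
  have hbig : ∀ n : ℕ, 4 * R ^ 2 ≤ v (n + l) := by
    intro n
    have h := hlin (n + l)
    push_cast at h
    have : (0 : ℝ) ≤ n := Nat.cast_nonneg n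
    linarith
  refine ⟨l, fun n => ?_⟩
  induction n with
  | zero => have := hbig 0; rw [hu0]; nlinarith
  | succ k ih =>
    have hb := hbig k
    have e : k + 1 + l = k + l + 1 := by ring
    rw [e, hv, hu]
    have h1 : Real.exp (R * u k) ≤ Real.exp (v (k + l) / 2) :=
      Real.exp_le_exp.mpr (by linarith)
    have h2 : 2 * R ^ 2 ≤ Real.exp (v (k + l) / 2) := by
      have := Real.add_one_le_exp (v (k + l) / 2)
      linarith
    have h3 : Real.exp (v (k + l)) = Real.exp (v (k + l) / 2) * Real.exp (v (k + l) / 2) := by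
      rw [← Real.exp_add]; congr 1; ring
    rw [h3]
    calc 2 * R * (R * Real.exp (R * u k)) = 2 * R ^ 2 * Real.exp (R * u k) := by ring
      _ ≤ _ := mul_le_mul h2 h1 (Real.exp_pos _).le (Real.exp_pos _).le
end

section
/- Let r > 0 and let 𝒬_r be the partition of ℂ into the closed grid squares Q_r^{m,n} = {z : mr ≤ Re z ≤ (m+1)r, nr ≤ Im z ≤ (n+1)r}, m, n ∈ ℤ. Let γ : [0,1] → ℂ be a continuous curve whose length (total variation) is at most l > 0. Then the number of grid squares in 𝒬_r that intersect γ([0,1]) is at most 12 + 2√2·l/r. -/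
/-- The closed grid square `Q_r^{m,n}`. -/
def gridSq (r : ℝ) (m n : ℤ) : Set ℂ :=
  {z : ℂ | m * r ≤ z.re ∧ z.re ≤ (m + 1) * r ∧ n * r ≤ z.im ∧ z.im ≤ (n + 1) * r}

noncomputable def vbox (X Y : ℤ) : Finset (ℤ × ℤ) := Finset.Icc (X-1) X ×ˢ Finset.Icc (Y-1) Y

lemma vbox_mem {X Y m n : ℤ} {x y : ℝ} (hx : |x - X| < 1) (hy : |y - Y| < 1)
    (h1 : (m:ℝ) ≤ x) (h2 : x ≤ m + 1) (h3 : (n:ℝ) ≤ y) (h4 : y ≤ n + 1) : (m, n) ∈ vbox X Y := by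
  rw [abs_lt] at hx hy
  have a1 : m < X + 1 := by exact_mod_cast (by push_cast; linarith : (m:ℝ) < ((X + 1 : ℤ) : ℝ))
  have a2 : X < m + 1 + 1 := by
    exact_mod_cast (by push_cast; linarith : (X:ℝ) < ((m + 1 + 1 : ℤ) : ℝ))
  have a3 : n < Y + 1 := by exact_mod_cast (by push_cast; linarith : (n:ℝ) < ((Y + 1 : ℤ) : ℝ))
  have a4 : Y < n + 1 + 1 := by
    exact_mod_cast (by push_cast; linarith : (Y:ℝ) < ((n + 1 + 1 : ℤ) : ℝ))
  simp only [vbox, Finset.mem_product, Finset.mem_Icc]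
  omega

lemma vbox_card (X Y : ℤ) : (vbox X Y).card = 4 := by
  simp [vbox]

lemma vbox_sdiff (X Y X' Y' : ℤ) (hX : |X' - X| ≤ 1) (hY : |Y' - Y| ≤ 1) :
    ((vbox X' Y' \ vbox X Y).card : ℤ) ≤ 2 * (|X' - X| + |Y' - Y|) := by
  have key : ∀ S : Finset (ℤ × ℤ), S ⊆ vbox X' Y' → S ⊆ vbox X Y →
      ((vbox X' Y' \ vbox X Y).card : ℤ) ≤ 4 - S.card := by
    intro S h1 h2
    have h3 : vbox X' Y' \ vbox X Y ⊆ vbox X' Y' \ S := Finset.sdiff_subset_sdiff le_rfl h2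
    have h4 := Finset.card_le_card h3
    rw [Finset.card_sdiff_of_subset h1, vbox_card] at h4
    have h5 := Finset.card_le_card h1
    rw [vbox_card] at h5
    omega
  have hX' : X' = X ∨ X' = X + 1 ∨ X' = X - 1 := by rw [abs_le] at hX; omega
  have hY' : Y' = Y ∨ Y' = Y + 1 ∨ Y' = Y - 1 := by rw [abs_le] at hY; omega
  by_cases hx : X' = X
  · by_cases hy : Y' = Y
    · subst hx hy; simp
    · have e : |Y' - Y| = 1 := by
        rcases hY' with h | h | h
        · exact absurd h hy
        · subst h; simp
        · subst h; simp
      subst hx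
      have := key (Finset.Icc (X'-1) X' ×ˢ {max Y Y' - 1})
        (by intro p hp
            simp only [vbox, Finset.mem_product, Finset.mem_Icc, Finset.mem_singleton] at hp ⊢
            omega)
        (by intro p hp
            simp only [vbox, Finset.mem_product, Finset.mem_Icc, Finset.mem_singleton] at hp ⊢
            omega)
      simp at this
      simp only [e, sub_self, abs_zero]
      omega
  · have e1 : |X' - X| = 1 := by
      rcases hX' with h | h | h
      · exact absurd h hx
      · subst h; simp
      · subst h; simp
    by_cases hy : Y' = Y
    · subst hy
      have := key ({max X X' - 1} ×ˢ Finset.Icc (Y'-1) Y')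
        (by intro p hp
            simp only [vbox, Finset.mem_product, Finset.mem_Icc, Finset.mem_singleton] at hp ⊢
            omega)
        (by intro p hp
            simp only [vbox, Finset.mem_product, Finset.mem_Icc, Finset.mem_singleton] at hp ⊢
            omega)
      simp at this
      simp only [e1, sub_self, abs_zero]
      omega
    · have e : |Y' - Y| = 1 := by
        rcases hY' with h | h | h
        · exact absurd h hy
        · subst h; simp
        · subst h; simp
      have := key ∅ (by simp) (by simp)
      simp at this
      rw [e, e1]
      omega

lemma one_dim (u : ℝ → ℝ) (a b : ℝ) (hab : a ≤ b) (hu : ContinuousOn u (Set.Icc a b)) (X : ℤ)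
    (hX : |u a - X| < 1) (hosc : ∀ s ∈ Set.Icc a b, ∀ t ∈ Set.Icc a b, |u s - u t| < 1) :
    ∃ X' : ℤ, ∃ s ∈ Set.Icc a b, |X' - X| ≤ 1 ∧ (∀ t ∈ Set.Icc a b, |u t - X'| < 1) ∧
      ((|X' - X| : ℤ) : ℝ) + |u b - X'| - |u a - X| ≤ |u s - u a| + |u b - u s| := by
  by_cases h : ∀ t ∈ Set.Icc a b, |u t - X| < 1
  · refine ⟨X, a, ⟨le_rfl, hab⟩, by simp, h, ?_⟩
    have := abs_add_le (u b - u a) (u a - X)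
    simp at this ⊢
    linarith
  · push Not at h
    obtain ⟨t, ht, h1⟩ := h
    have hX2 := abs_lt.1 hX
    have hc : ContinuousOn u (Set.Icc a t) := hu.mono (Set.Icc_subset_Icc le_rfl ht.2)
    rcases le_abs.1 h1 with h2 | h2
    · obtain ⟨s, hs, hs'⟩ := intermediate_value_Icc ht.1 hc
        (show (X:ℝ) + 1 ∈ _ from ⟨by linarith, by linarith⟩)
      have hsm : s ∈ Set.Icc a b := ⟨hs.1, hs.2.trans ht.2⟩
      refine ⟨X + 1, s, hsm, by simp, ?_, ?_⟩
      · intro q hq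
        have := hosc q hq s hsm
        rw [hs'] at this; push_cast; exact this
      · have := abs_add_le ((X:ℝ) + 1 - u a) (u a - X)
        simp at this
        rw [hs']; push_cast; simp
        linarith
    · obtain ⟨s, hs, hs'⟩ := intermediate_value_Icc' ht.1 hc
        (show (X:ℝ) - 1 ∈ _ from ⟨by linarith, by linarith⟩)
      have hsm : s ∈ Set.Icc a b := ⟨hs.1, hs.2.trans ht.2⟩
      refine ⟨X - 1, s, hsm, by simp, ?_, ?_⟩
      · intro q hq
        have := hosc q hq s hsm
        rw [hs'] at this; push_cast; exact this
      · have := abs_add_le ((X:ℝ) - 1 - u a) (u a - X)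
        simp at this
        rw [hs']; push_cast; simp
        linarith

def GoodAt (u v f : ℝ → ℝ) (t : ℝ) : Prop :=
  ∃ A : Finset (ℤ × ℤ), ∃ X Y : ℤ, |u t - X| < 1 ∧ |v t - Y| < 1 ∧ vbox X Y ⊆ A ∧
    (∀ s ∈ Set.Icc 0 t, ∀ m n : ℤ, (m:ℝ) ≤ u s → u s ≤ m + 1 → (n:ℝ) ≤ v s → v s ≤ n + 1 →
      (m, n) ∈ A) ∧ (A.card : ℝ) ≤ 4 + 2 * (f t - f 0 + 2 - |u t - X| - |v t - Y|)

lemma two_times (u v f : ℝ → ℝ) (a b : ℝ)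
    (hf : ∀ s ∈ Set.Icc a b, ∀ t ∈ Set.Icc a b, s ≤ t → |u t - u s| + |v t - v s| ≤ f t - f s)
    (s t : ℝ) (hs : s ∈ Set.Icc a b) (ht : t ∈ Set.Icc a b) :
    |u s - u a| + |u b - u s| + (|v t - v a| + |v b - v t|) ≤ f b - f a := by
  have hab : a ≤ b := hs.1.trans hs.2
  have ha : a ∈ Set.Icc a b := ⟨le_rfl, hab⟩
  have hb : b ∈ Set.Icc a b := ⟨hab, le_rfl⟩
  rcases le_total s t with h | h
  · have h1 := hf a ha s hs hs.1
    have h2 := hf s hs t ht h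
    have h3 := hf t ht b hb ht.2
    have h4 := abs_sub_le (u b) (u t) (u s)
    have h5 := abs_sub_le (v t) (v s) (v a)
    linarith
  · have h1 := hf a ha t ht ht.1
    have h2 := hf t ht s hs h
    have h3 := hf s hs b hb hs.2
    have h4 := abs_sub_le (u s) (u t) (u a)
    have h5 := abs_sub_le (v b) (v s) (v t)
    linarith

lemma good_step (u v f : ℝ → ℝ) (a b : ℝ) (hab : a ≤ b)
    (hu : ContinuousOn u (Set.Icc a b)) (hv : ContinuousOn v (Set.Icc a b))
    (hou : ∀ s ∈ Set.Icc a b, ∀ t ∈ Set.Icc a b, |u s - u t| < 1)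
    (hov : ∀ s ∈ Set.Icc a b, ∀ t ∈ Set.Icc a b, |v s - v t| < 1)
    (hf : ∀ s ∈ Set.Icc a b, ∀ t ∈ Set.Icc a b, s ≤ t → |u t - u s| + |v t - v s| ≤ f t - f s)
    (h : GoodAt u v f a) : GoodAt u v f b := by
  obtain ⟨A, X, Y, hX, hY, hbox, hcov, hcard⟩ := h
  obtain ⟨X', s, hs, hX1, hX2, hX3⟩ := one_dim u a b hab hu X hX hou
  obtain ⟨Y', t, ht, hY1, hY2, hY3⟩ := one_dim v a b hab hv Y hY hov
  have hb : b ∈ Set.Icc a b := ⟨hab, le_rfl⟩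
  refine ⟨A ∪ vbox X' Y', X', Y', hX2 b hb, hY2 b hb, Finset.subset_union_right, ?_, ?_⟩
  · intro q hq m n h1 h2 h3 h4
    rcases le_total q a with h | h
    · exact Finset.mem_union_left _ (hcov q ⟨hq.1, h⟩ m n h1 h2 h3 h4)
    · exact Finset.mem_union_right _
        (vbox_mem (hX2 q ⟨h, hq.2⟩) (hY2 q ⟨h, hq.2⟩) h1 h2 h3 h4)
  · have h1 : (A ∪ vbox X' Y').card ≤ A.card + (vbox X' Y' \ vbox X Y).card := by
      rw [← Finset.union_sdiff_self_eq_union]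
      refine (Finset.card_union_le _ _).trans ?_
      gcongr
    have h2 := vbox_sdiff X Y X' Y' hX1 hY1
    have h1' : ((A ∪ vbox X' Y').card : ℝ) ≤ A.card + (vbox X' Y' \ vbox X Y).card := by
      exact_mod_cast h1
    have h2' : ((vbox X' Y' \ vbox X Y).card : ℝ) ≤
        2 * (((|X' - X| : ℤ) : ℝ) + ((|Y' - Y| : ℤ) : ℝ)) := by
      exact_mod_cast h2
    have h3 := two_times u v f a b hf s t hs ht
    linarith

lemma good_one (u v f : ℝ → ℝ)
    (hu : ContinuousOn u (Set.Icc 0 1)) (hv : ContinuousOn v (Set.Icc 0 1))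
    (hf : ∀ s ∈ Set.Icc (0:ℝ) 1, ∀ t ∈ Set.Icc (0:ℝ) 1, s ≤ t →
      |u t - u s| + |v t - v s| ≤ f t - f s) : GoodAt u v f 1 := by
  have huu := isCompact_Icc.uniformContinuousOn_of_continuous hu
  have hvv := isCompact_Icc.uniformContinuousOn_of_continuous hv
  rw [Metric.uniformContinuousOn_iff] at huu hvv
  obtain ⟨d1, hd1, hu1⟩ := huu 1 one_pos
  obtain ⟨d2, hd2, hv1⟩ := hvv 1 one_pos
  obtain ⟨k, hk⟩ := exists_nat_one_div_lt (lt_min hd1 hd2)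
  set N : ℝ := (k:ℝ) + 1 with hN
  have hNpos : 0 < N := by positivity
  have main : ∀ i : ℕ, i ≤ k + 1 → GoodAt u v f (i / N) := by
    intro i
    induction i with
    | zero =>
      intro _
      have e1 : |u 0 - ⌊u 0⌋| < 1 := by
        rw [abs_lt]; constructor <;> linarith [Int.floor_le (u 0), Int.lt_floor_add_one (u 0)]
      have e2 : |v 0 - ⌊v 0⌋| < 1 := by
        rw [abs_lt]; constructor <;> linarith [Int.floor_le (v 0), Int.lt_floor_add_one (v 0)]
      simp only [Nat.cast_zero, zero_div]
      refine ⟨vbox ⌊u 0⌋ ⌊v 0⌋, ⌊u 0⌋, ⌊v 0⌋, e1, e2, le_rfl, ?_, ?_⟩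
      · intro s hs m n h1 h2 h3 h4
        have : s = 0 := le_antisymm hs.2 hs.1
        subst this
        exact vbox_mem e1 e2 h1 h2 h3 h4
      · rw [vbox_card]; push_cast; linarith
    | succ i ih =>
      intro hi
      have hb1 : ((i + 1 : ℕ) : ℝ) / N ≤ 1 := by
        rw [div_le_one hNpos, hN]; exact_mod_cast hi
      have ha0 : 0 ≤ (i:ℝ) / N := by positivity
      have hstep : ((i + 1 : ℕ) : ℝ) / N = i / N + 1 / N := by push_cast; ring
      have hp : 0 < 1 / N := by positivity
      have hsub : Set.Icc ((i:ℝ) / N) (((i + 1 : ℕ) : ℝ) / N) ⊆ Set.Icc 0 1 :=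
        Set.Icc_subset_Icc ha0 hb1
      have hd : ∀ s ∈ Set.Icc ((i:ℝ) / N) (((i + 1 : ℕ) : ℝ) / N),
          ∀ t ∈ Set.Icc ((i:ℝ) / N) (((i + 1 : ℕ) : ℝ) / N), dist s t < min d1 d2 := by
        intro s hs t ht
        refine lt_of_le_of_lt ?_ hk
        have := Real.dist_le_of_mem_Icc hs ht
        linarith
      refine good_step u v f _ _ (by linarith) (hu.mono hsub) (hv.mono hsub) ?_ ?_ ?_
        (ih (by omega))
      · intro s hs t ht
        exact hu1 s (hsub hs) t (hsub ht) ((hd s hs t ht).trans_le (min_le_left _ _))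
      · intro s hs t ht
        exact hv1 s (hsub hs) t (hsub ht) ((hd s hs t ht).trans_le (min_le_right _ _))
      · intro s hs t ht
        exact hf s (hsub hs) t (hsub ht)
  have := main (k + 1) le_rfl
  have e : ((k + 1 : ℕ) : ℝ) / N = 1 := by
    rw [hN]; push_cast; exact div_self hNpos.ne'
  rwa [e] at this

lemma l1_le (z : ℂ) : |z.re| + |z.im| ≤ Real.sqrt 2 * ‖z‖ := by
  have h1 : ‖z‖ ^ 2 = z.re ^ 2 + z.im ^ 2 := by
    rw [Complex.sq_norm, Complex.normSq_apply]; ring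
  have h2 : Real.sqrt 2 ^ 2 = 2 := Real.sq_sqrt (by norm_num)
  refine abs_le_of_sq_le_sq' ?_ (by positivity) |>.2
  rw [mul_pow, h1, h2]
  nlinarith [sq_nonneg (|z.re| - |z.im|), sq_abs z.re, sq_abs z.im]

theorem curve_meets_few_grid_squares
    (r : ℝ) (hr : 0 < r) (l : ℝ) (hl : 0 < l)
    (γ : ℝ → ℂ) (hcont : ContinuousOn γ (Set.Icc 0 1))
    (hlen : eVariationOn γ (Set.Icc 0 1) ≤ ENNReal.ofReal l) :
    {p : ℤ × ℤ | (gridSq r p.1 p.2 ∩ γ '' Set.Icc 0 1).Nonempty}.Finite ∧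
      (({p : ℤ × ℤ | (gridSq r p.1 p.2 ∩ γ '' Set.Icc 0 1).Nonempty}.ncard : ℝ) ≤
        12 + 2 * Real.sqrt 2 * l / r) := by
  have hfin : ∀ a b : ℝ, 0 ≤ a → b ≤ 1 → eVariationOn γ (Set.Icc a b) ≠ ⊤ := fun a b ha hb =>
    ne_top_of_le_ne_top ENNReal.ofReal_ne_top
      ((eVariationOn.mono γ (Set.Icc_subset_Icc ha hb)).trans hlen)
  set g : ℝ → ℝ := fun t => (eVariationOn γ (Set.Icc 0 t)).toReal with hg
  have hgd : ∀ s ∈ Set.Icc (0:ℝ) 1, ∀ t ∈ Set.Icc (0:ℝ) 1, s ≤ t → ‖γ t - γ s‖ ≤ g t - g s := by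
    intro s hs t ht hst
    have h1 := eVariationOn.Icc_add_Icc γ (s := Set.univ) hs.1 hst (Set.mem_univ _)
    simp only [Set.univ_inter] at h1
    have h2 : g t = g s + (eVariationOn γ (Set.Icc s t)).toReal := by
      simp only [hg]
      rw [← h1, ENNReal.toReal_add (hfin _ _ le_rfl hs.2) (hfin _ _ hs.1 ht.2)]
    have h3 := eVariationOn.edist_le γ (s := Set.Icc s t) (x := t) (y := s) ⟨hst, le_rfl⟩ ⟨le_rfl, hst⟩
    have h4 := ENNReal.toReal_mono (hfin _ _ hs.1 ht.2) h3
    rw [← dist_edist, dist_eq_norm] at h4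
    linarith
  have hg1 : g 1 ≤ l := ENNReal.toReal_le_of_le_ofReal hl.le hlen
  have hg0 : 0 ≤ g 0 := ENNReal.toReal_nonneg
  obtain ⟨A, X, Y, -, -, -, hcov, hcard⟩ := good_one (fun t => (γ t).re / r)
    (fun t => (γ t).im / r) (fun t => Real.sqrt 2 * g t / r)
    ((Complex.continuous_re.comp_continuousOn hcont).div_const r)
    ((Complex.continuous_im.comp_continuousOn hcont).div_const r) (by
      intro s hs t ht hst
      have h1 := l1_le (γ t - γ s)
      have h2 := mul_le_mul_of_nonneg_left (hgd s hs t ht hst) (Real.sqrt_nonneg 2)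
      simp only [← sub_div, abs_div, abs_of_pos hr, ← add_div]
      rw [Complex.sub_re, Complex.sub_im] at h1
      gcongr
      linarith)
  have hsub : {p : ℤ × ℤ | (gridSq r p.1 p.2 ∩ γ '' Set.Icc 0 1).Nonempty} ⊆ (A : Set (ℤ × ℤ)) := by
    rintro ⟨m, n⟩ ⟨z, ⟨h1, h2, h3, h4⟩, s, hs, rfl⟩
    exact hcov s hs m n ((le_div_iff₀ hr).2 h1) ((div_le_iff₀ hr).2 h2)
      ((le_div_iff₀ hr).2 h3) ((div_le_iff₀ hr).2 h4)
  refine ⟨A.finite_toSet.subset hsub, ?_⟩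
  have h1 := Set.ncard_le_ncard hsub A.finite_toSet
  rw [Set.ncard_coe_finset] at h1
  have h1' : (({p : ℤ × ℤ | (gridSq r p.1 p.2 ∩ γ '' Set.Icc 0 1).Nonempty}.ncard : ℝ)) ≤ A.card := by
    exact_mod_cast h1
  have h2 : Real.sqrt 2 * g 1 / r ≤ Real.sqrt 2 * l / r := by gcongr
  have h3 : 0 ≤ Real.sqrt 2 * g 0 / r := by positivity
  have h4 : 2 * Real.sqrt 2 * l / r = 2 * (Real.sqrt 2 * l / r) := by ring
  have h5 := abs_nonneg ((γ 1).re / r - X)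
  have h6 := abs_nonneg ((γ 1).im / r - Y)
  rw [h4]
  simp only at hcard
  linarith
end
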